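/- arXiv:1606.05954 — 6 statements merged into one kernel-verified Lean document; each statement's English description precedes it below -/
import Mathlib

section
/- For all positive integers j and k with j ≤ k, letting p be the smallest prime number satisfying p ≥ k, there exists a j×k integer matrix Γ such that (i) every entry of Γ is a non-negative integer smaller than p, and (ii) for every set T of j column indices, the j columns of Γ indexed by T, regarded as vectors in ℝ^j, are linearly independent over ℝ. -/
/-- A square integer matrix whose reduction modulo `p` has nonzero determinant has linearly
independent rows over any field of characteristic zero. -/
theorem linearIndependent_row_map_intCast_of_det_zmod_ne_zero {n K : Type*} [Fintype n]
    [DecidableEq n] [Field K] [CharZero K] (p : ℕ) (M : Matrix n n ℤ)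
    (h : (M.map (Int.cast : ℤ → ZMod p)).det ≠ 0) :
    LinearIndependent K (M.map (Int.cast : ℤ → K)).row := by
  refine Matrix.linearIndependent_rows_of_det_ne_zero (A := M.map (Int.cast : ℤ → K)) ?_
  have hK : (M.map (Int.cast : ℤ → K)).det = (M.det : K) :=
    ((Int.castRingHom K).map_det M).symm
  have hp : (M.map (Int.cast : ℤ → ZMod p)).det = (M.det : ZMod p) :=
    ((Int.castRingHom (ZMod p)).map_det M).symm
  rw [hK, Int.cast_ne_zero]
  intro h0
  exact h (by rw [hp, h0, Int.cast_zero])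

/-- **Lemma 2 of the paper.** For all positive integers `j ≤ k`, letting `p` be the smallest
prime with `p ≥ k`, there is a `j × k` integer matrix `Γ` whose entries are non-negative
integers smaller than `p` and such that any `j` of its columns, regarded as vectors in `ℝ^j`,
are linearly independent over `ℝ`. -/
theorem snc_generator_matrix_exists (j k : ℕ) (hj : 0 < j) (hjk : j ≤ k)
    (p : ℕ) (hp : p.Prime) (hkp : k ≤ p)
    (hpmin : ∀ q : ℕ, q.Prime → k ≤ q → p ≤ q) :
    ∃ Γ : Matrix (Fin j) (Fin k) ℤ,
      (∀ i l, 0 ≤ Γ i l ∧ Γ i l < (p : ℤ)) ∧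
      (∀ T : Finset (Fin k), T.card = j →
        LinearIndependent ℝ (fun l : ↥T => fun i : Fin j => (Γ i l.1 : ℝ))) := by
  have := Fact.mk hp
  refine ⟨Matrix.of fun i l => ((((l : ℕ) : ZMod p) ^ (i : ℕ)).val : ℤ), fun i l =>
    ⟨Int.natCast_nonneg _, Int.ofNat_lt.mpr (ZMod.val_lt _)⟩, fun T hT => ?_⟩
  let e : Fin j ≃ T := (T.equivFinOfCardEq hT).symm
  rw [← linearIndependent_equiv e]
  refine linearIndependent_row_map_intCast_of_det_zmod_ne_zero (K := ℝ) p
    (Matrix.of fun a b : Fin j => (((((e a).1 : ℕ) : ZMod p) ^ (b : ℕ)).val : ℤ)) ?_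
  have hV : (Matrix.of fun a b : Fin j =>
      (((((e a).1 : ℕ) : ZMod p) ^ (b : ℕ)).val : ℤ)).map (Int.cast : ℤ → ZMod p) =
      Matrix.vandermonde fun a : Fin j => (((e a).1 : ℕ) : ZMod p) := by
    ext a b
    simp [Matrix.vandermonde_apply]
  rw [hV, Matrix.det_vandermonde_ne_zero_iff]
  intro a b hab
  have hlt (c : Fin j) : ((e c).1 : ℕ) < p := (e c).1.isLt.trans_le hkp
  refine e.injective (Subtype.ext (Fin.ext ?_))
  exact Nat.ModEq.eq_of_lt_of_lt ((ZMod.natCast_eq_natCast_iff _ _ _).mp hab) (hlt a) (hlt b)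
end

section
/- Let M ≥ 2 and 1 ≤ N ≤ M−1 be integers and set W = M−N. Let Γ be a real matrix with W(M−1) rows and M(M−1) columns, the columns being indexed by pairs (k,j) with k ∈ {1,…,M} and j ∈ {1,…,M−1}, such that every W(M−1) columns of Γ are linearly independent over ℝ. Then for all nonzero real numbers h_1,…,h_M and arbitrary real numbers μ_{a,b} (a ∈ {1,…,N}, b ∈ {1,…,M−1}), there exist real numbers ρ_{k,j} (k ∈ {N+1,…,M}, j ∈ {1,…,M−1}) such that for every row vector F ∈ ℝ^{W(M−1)}, writing L = FΓ (so L has entries L_{k,j}), one has Σ_{a=1}^{N} Σ_{b=1}^{M−1} h_a μ_{a,b} L_{a,b} + Σ_{k=N+1}^{M} Σ_{j=1}^{M−1} h_k ρ_{k,j} L_{k,j} = 0. -/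
/-- A full-size linearly independent family of columns spans the whole column space. -/
lemma exists_sum_smul_col_eq {K m n : Type*} [Field K] [Fintype m] (A : Matrix m n K)
    (T : Finset n) (hcard : T.card = Fintype.card m)
    (hT : LinearIndependent K (fun c : ↥T => fun r => A r c.1)) (v : m → K) :
    ∃ g : n → K, ∑ p ∈ T, g p • (fun r => A r p) = v := by
  have hspan := hT.span_eq_top_of_card_eq_finrank' (by simp [hcard])
  have hv : v ∈ Submodule.span K ((fun p r => A r p) '' (T : Set n)) := by
    rw [Set.image_eq_range]
    exact hspan ▸ Submodule.mem_top
  exact (Submodule.mem_span_image_finset_iff_exists_fun' K).1 hv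

/-- The number of pairs in `Fin M × Fin n` whose first coordinate is at least `N`. -/
lemma card_filter_le_fst (M N n : ℕ) :
    (Finset.univ.filter fun p : Fin M × Fin n => N ≤ (p.1 : ℕ)).card = (M - N) * n := by
  have hfst : (Finset.univ.filter fun k : Fin M => N ≤ (k : ℕ)).card = M - N := by
    rw [← Finset.card_map Fin.valEmbedding, ← Nat.card_Ico]
    congr 1
    ext x
    simp only [Finset.mem_map, Finset.mem_filter_univ, Fin.valEmbedding_apply, Finset.mem_Ico]
    exact ⟨fun ⟨k, hk, hx⟩ => hx ▸ ⟨hk, k.2⟩, fun hx => ⟨⟨x, hx.2⟩, hx.1, rfl⟩⟩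
  have hprod : (Finset.univ.filter fun p : Fin M × Fin n => N ≤ (p.1 : ℕ)) =
      (Finset.univ.filter fun k : Fin M => N ≤ (k : ℕ)) ×ˢ Finset.univ := by
    ext p
    simp
  rw [hprod, Finset.card_product, hfst, Finset.card_univ, Fintype.card_fin]


/-- **Beamforming cancellation in the S-BCJ-SNC scheme.** Let `2 ≤ M`, `1 ≤ N ≤ M - 1`,
`W = M - N`, and let `Γ` be a real matrix with `W * (M-1)` rows, columns indexed by pairs
`(k, j) ∈ Fin M × Fin (M-1)`, such that every `W * (M-1)` columns of `Γ` are linearly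
independent over `ℝ`. Then for all nonzero `h k` and arbitrary `μ a b` there exist precoding
coefficients `ρ k j` (used for `k ≥ N`) such that for every row vector `F`, writing
`L = F Γ`, the sum `∑_{a < N} ∑_b h a * μ a b * L (a, b) + ∑_{k ≥ N} ∑_j h k * ρ k j * L (k, j)`
vanishes. -/
theorem sbcj_snc_beamforming (M N : ℕ) (hM : 2 ≤ M) (hN : 1 ≤ N) (hNM : N ≤ M - 1)
    (Γ : Matrix (Fin ((M - N) * (M - 1))) (Fin M × Fin (M - 1)) ℝ)
    (hΓ : ∀ T : Finset (Fin M × Fin (M - 1)), T.card = (M - N) * (M - 1) →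
      LinearIndependent ℝ (fun c : ↥T => fun r : Fin ((M - N) * (M - 1)) => Γ r c.1))
    (h : Fin M → ℝ) (hh : ∀ k, h k ≠ 0)
    (μ : Fin N → Fin (M - 1) → ℝ) :
    ∃ ρ : Fin M → Fin (M - 1) → ℝ,
      ∀ F : Fin ((M - N) * (M - 1)) → ℝ,
        (∑ a : Fin N, ∑ b : Fin (M - 1),
            h (Fin.castLE (by omega) a) * μ a b *
              Matrix.vecMul F Γ (Fin.castLE (by omega) a, b)) +
        (∑ k : Fin M, ∑ j : Fin (M - 1),
            if N ≤ (k : ℕ) then h k * ρ k j * Matrix.vecMul F Γ (k, j) else 0) = 0 := by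
  obtain ⟨g, hg⟩ := exists_sum_smul_col_eq Γ _ (by simp [card_filter_le_fst M N (M - 1)])
    (hΓ _ (card_filter_le_fst M N (M - 1)))
    (-∑ a : Fin N, ∑ b : Fin (M - 1), (h (Fin.castLE (by omega) a) * μ a b) •
      fun r => Γ r (Fin.castLE (by omega) a, b))
  refine ⟨fun k j => g (k, j) / h k, fun F => ?_⟩
  have hF := congrArg (fun v => F ⬝ᵥ v) hg
  simp only [dotProduct_neg, dotProduct_sum, dotProduct_smul, smul_eq_mul] at hF
  rw [Finset.sum_filter, Fintype.sum_prod_type] at hF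
  rw [add_comm, ← eq_neg_iff_add_eq_zero]
  simp only [mul_div_cancel₀ _ (hh _)]
  exact hF
end

section
/- Let M ≥ 2 and 2 ≤ N ≤ M−1 be integers and set W = M−N. Let Γ be a real matrix with 2W rows and 2M columns such that every 2W columns of Γ are linearly independent over ℝ, and let h_1,…,h_M be nonzero real numbers. For k ∈ {1,…,N}, let [k+1]_N denote k+1 if k < N and 1 if k = N. Then there exist real numbers ρ_{2N+1},…,ρ_{2M} such that for all real numbers V_1,…,V_N, U_1,…,U_N and every row vector F ∈ ℝ^{2W}, writing L = FΓ ∈ ℝ^{2M}, one has Σ_{k=1}^{N} h_k · ( V_k + U_k + L_{2k−1} − (h_{[k+1]_N}/h_k) · ( U_{[k+1]_N} + L_{2k} ) ) + Σ_{k=N+1}^{M} h_k · ( ρ_{2k−1} L_{2k−1} + ρ_{2k} L_{2k} ) = Σ_{k=1}^{N} h_k V_k. -/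
/-- A sum over `Fin (2 * M)` splits into consecutive pairs. -/
lemma Fin.sum_univ_two_mul_pairs {A : Type*} [AddCommMonoid A] (M : ℕ) (f : Fin (2 * M) → A) :
    ∑ c, f c = ∑ k : Fin M, (f ⟨2 * k.1, by have := k.isLt; omega⟩ +
      f ⟨2 * k.1 + 1, by have := k.isLt; omega⟩) := by
  induction M with
  | zero => rfl
  | succ m ih =>
    rw [Fin.sum_univ_castSucc (n := m)]
    refine (Fin.sum_univ_castSucc (n := 2 * m + 1) f).trans ?_
    rw [Fin.sum_univ_castSucc, ih, add_assoc]
    rfl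

/-- The cyclic successor permutes `Fin N`, so it leaves sums unchanged. -/
lemma Fin.sum_univ_cyclic_succ {A : Type*} [AddCommMonoid A] {N : ℕ} (hN : 0 < N)
    (f : Fin N → A) :
    ∑ k : Fin N, f ⟨(k.1 + 1) % N, Nat.mod_lt _ hN⟩ = ∑ k, f k := by
  have hinj : Function.Injective fun k : Fin N ↦ (⟨(k.1 + 1) % N, Nat.mod_lt _ hN⟩ : Fin N) := by
    intro a b hab
    have hmod : a.1 ≡ b.1 [MOD N] := Nat.ModEq.add_right_cancel' 1 (Fin.mk.inj hab)
    exact Fin.ext (hmod.eq_of_lt_of_lt a.isLt b.isLt)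
  exact (Finite.injective_iff_bijective.mp hinj).sum_comp f

/-- If the columns of `Γ` indexed by `T` are independent and as many as the rows, every linear
functional of a row vector `F` is a combination of the entries of `F Γ` indexed by `T`. -/
lemma Matrix.exists_dotProduct_eq_sum_vecMul {K m n : Type*} [Field K] [Fintype m] [Fintype n]
    (Γ : Matrix m n K) (T : Finset n) (hcard : T.card = Fintype.card m)
    (hT : LinearIndependent K (fun c : ↥T => fun r => Γ r c.1)) (b : m → K) :
    ∃ σ : n → K, (∀ c ∉ T, σ c = 0) ∧
      ∀ F : m → K, F ⬝ᵥ b = ∑ c, σ c * Matrix.vecMul F Γ c := by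
  classical
  have hspan := hT.span_eq_top_of_card_eq_finrank' (by simp [hcard])
  have hb : b ∈ Submodule.span K (Set.range fun c : ↥T => fun r => Γ r c.1) :=
    hspan ▸ Submodule.mem_top
  obtain ⟨τ, rfl⟩ := (Submodule.mem_span_range_iff_exists_fun K).mp hb
  refine ⟨fun c ↦ if hc : c ∈ T then τ ⟨c, hc⟩ else 0, fun c hc ↦ dif_neg hc, fun F ↦ ?_⟩
  rw [dotProduct_sum, ← Finset.sum_subset (Finset.subset_univ T)
    (fun c _ hc ↦ by simp [hc]), ← Finset.sum_coe_sort T]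
  refine Finset.sum_congr rfl fun c _ ↦ ?_
  rw [dotProduct_smul]
  simp only [Finset.coe_mem, dif_pos]
  rfl

/-- **Beamforming cancellation in the S-CoJ-SNC scheme.** Let `2 ≤ M`, `2 ≤ N ≤ M - 1`,
`W = M - N`, let `Γ` be a real matrix with `2W` rows and `2M` columns such that every `2W`
columns are linearly independent over `ℝ`, and let `h k` be nonzero reals. Then there exist
precoding coefficients `ρ` (used at indices `≥ 2N`) such that for all `V`, `U` and every row
vector `F`, writing `L = F Γ`, the destination's received combination equals `∑ k, h k * V k`:
all noise symbols `U` and all fictitious-message combinations `L` are cancelled. -/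
theorem scoj_snc_beamforming (M N : ℕ) (hM : 2 ≤ M) (hN : 2 ≤ N) (hNM : N ≤ M - 1)
    (Γ : Matrix (Fin (2 * (M - N))) (Fin (2 * M)) ℝ)
    (hΓ : ∀ T : Finset (Fin (2 * M)), T.card = 2 * (M - N) →
      LinearIndependent ℝ (fun c : ↥T => fun r : Fin (2 * (M - N)) => Γ r c.1))
    (h : Fin M → ℝ) (hh : ∀ k, h k ≠ 0) :
    ∃ ρ : Fin (2 * M) → ℝ,
      ∀ (V U : Fin N → ℝ) (F : Fin (2 * (M - N)) → ℝ),
        (∑ k : Fin N,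
            h (Fin.castLE (by omega) k) *
              (V k + U k + Matrix.vecMul F Γ ⟨2 * k.1, by have := k.isLt; omega⟩ -
                (h (Fin.castLE (by omega) ⟨(k.1 + 1) % N, Nat.mod_lt _ (by omega)⟩) /
                    h (Fin.castLE (by omega) k)) *
                  (U ⟨(k.1 + 1) % N, Nat.mod_lt _ (by omega)⟩ +
                    Matrix.vecMul F Γ ⟨2 * k.1 + 1, by have := k.isLt; omega⟩))) +
        (∑ k : Fin M,
            if N ≤ (k : ℕ) then
              h k * (ρ ⟨2 * k.1, by have := k.isLt; omega⟩ *
                  Matrix.vecMul F Γ ⟨2 * k.1, by have := k.isLt; omega⟩ +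
                ρ ⟨2 * k.1 + 1, by have := k.isLt; omega⟩ *
                  Matrix.vecMul F Γ ⟨2 * k.1 + 1, by have := k.isLt; omega⟩)
            else 0) =
        ∑ k : Fin N, h (Fin.castLE (by omega) k) * V k := by
  have hcard : (Finset.univ.filter fun c : Fin (2 * M) ↦ 2 * N ≤ c.1).card = 2 * (M - N) := by
    have hIci : (Finset.univ.filter fun c : Fin (2 * M) ↦ 2 * N ≤ c.1) =
        Finset.Ici (⟨2 * N, by omega⟩ : Fin (2 * M)) := by
      ext c
      simp [Fin.le_def]
    rw [hIci, Fin.card_Ici]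
    dsimp only
    omega
  let next : Fin N → Fin N := fun k ↦ ⟨(k.1 + 1) % N, Nat.mod_lt _ (by omega)⟩
  let g : Fin N → ℝ := fun k ↦ h (Fin.castLE (by omega) k)
  have hg : ∀ k, g k ≠ 0 := fun k ↦ hh _
  let b : Fin (2 * (M - N)) → ℝ := ∑ k : Fin N,
    (g (next k) • (fun r ↦ Γ r ⟨2 * k.1 + 1, by have := k.isLt; omega⟩) -
      g k • (fun r ↦ Γ r ⟨2 * k.1, by have := k.isLt; omega⟩))
  obtain ⟨σ, hσ, hσF⟩ :=
    Γ.exists_dotProduct_eq_sum_vecMul _ (by simpa using hcard) (hΓ _ hcard) b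
  refine ⟨fun c ↦ σ c / h ⟨c.1 / 2, by have := c.isLt; omega⟩, fun V U F ↦ ?_⟩
  have hrelay : (∑ k : Fin M, if N ≤ (k : ℕ) then
      h k * (σ ⟨2 * k.1, by have := k.isLt; omega⟩ / h ⟨2 * k.1 / 2, by have := k.isLt; omega⟩ *
          Matrix.vecMul F Γ ⟨2 * k.1, by have := k.isLt; omega⟩ +
        σ ⟨2 * k.1 + 1, by have := k.isLt; omega⟩ /
            h ⟨(2 * k.1 + 1) / 2, by have := k.isLt; omega⟩ *
          Matrix.vecMul F Γ ⟨2 * k.1 + 1, by have := k.isLt; omega⟩)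
      else 0) = F ⬝ᵥ b := by
    rw [hσF, Fin.sum_univ_two_mul_pairs]
    refine Finset.sum_congr rfl fun k _ ↦ ?_
    split_ifs with hk
    · have h0 : (⟨2 * k.1 / 2, by have := k.isLt; omega⟩ : Fin M) = k := Fin.ext (by simp)
      have h1 : (⟨(2 * k.1 + 1) / 2, by have := k.isLt; omega⟩ : Fin M) = k :=
        Fin.ext (by dsimp only; omega)
      rw [h0, h1]
      have := hh k
      field_simp
    · rw [hσ _ (by simp; omega), hσ _ (by simp; omega)]
      simp
  have hb : F ⬝ᵥ b = ∑ k : Fin N,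
      (g (next k) * Matrix.vecMul F Γ ⟨2 * k.1 + 1, by have := k.isLt; omega⟩ -
        g k * Matrix.vecMul F Γ ⟨2 * k.1, by have := k.isLt; omega⟩) := by
    rw [dotProduct_sum]
    refine Finset.sum_congr rfl fun k _ ↦ ?_
    rw [dotProduct_sub, dotProduct_smul, dotProduct_smul]
    rfl
  have hcyc : ∑ k, g (next k) * U (next k) = ∑ k, g k * U k :=
    Fin.sum_univ_cyclic_succ (by omega) fun k ↦ g k * U k
  have hnoise : ∑ k, (g k * U k - g (next k) * U (next k)) = 0 := by
    rw [Finset.sum_sub_distrib, hcyc, sub_self]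
  rw [hrelay, hb, ← Finset.sum_add_distrib, ← add_zero (∑ k : Fin N, _ * V k), ← hnoise,
    ← Finset.sum_add_distrib]
  refine Finset.sum_congr rfl fun k _ ↦ ?_
  change g k * (V k + U k + _ - g (next k) / g k * (U (next k) + _)) + _ = g k * V k + _
  have := hg k
  field_simp
  ring
end

section
/- Let A be a random vector taking values in a finite set 𝒜 ⊆ ℝ^τ, let λ_1,…,λ_τ be fixed real numbers, and suppose the real numbers {Σ_{k=1}^{τ} λ_k a_k : a ∈ 𝒜} are pairwise distinct with any two of them at distance at least d > 0. Let Z be a standard Gaussian random variable independent of A, and let Y = Σ_{k=1}^{τ} λ_k A_k + Z. Then the conditional Shannon entropy satisfies H(A | Y) ≤ log 2 + exp(−d²/8) · log|𝒜|. -/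
open MeasureTheory ProbabilityTheory

/-- The Shannon entropy (to the natural base) of a discrete probability measure `ν`,
`∑ₐ -ν{a} log ν{a}`. -/
noncomputable def measEnt {α : Type*} [MeasurableSpace α] (ν : Measure α) : ℝ :=
  ∑' a : α, Real.negMulLog (ν {a}).toReal

/-- Conditional Shannon entropy `H(A | Y)` of a random variable `A` given a real-valued
random variable `Y`: the expectation over `ω` of the entropy of the regular conditional
distribution of `A` given `Y`, evaluated at `Y ω`. -/
noncomputable def condEntReal {Ω α : Type*} [MeasurableSpace Ω] [MeasurableSpace α]
    [StandardBorelSpace α] [Nonempty α] (μ : Measure Ω) [IsFiniteMeasure μ]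
    (A : Ω → α) (Y : Ω → ℝ) : ℝ :=
  ∫ ω, measEnt (condDistrib A Y μ (Y ω)) ∂μ

/-- Tangent-line bound for `negMulLog` at the point `t`. -/
theorem negMulLog_le_tangent {x t : ℝ} (hx : 0 ≤ x) (ht : 0 < t) :
    Real.negMulLog x ≤ -Real.log t * x + (t - x) := by
  rcases hx.eq_or_lt with rfl | hx
  · simpa using ht.le
  · have h := mul_le_mul_of_nonneg_left (Real.log_le_sub_one_of_pos (div_pos ht hx)) hx.le
    rw [Real.log_div ht.ne' hx.ne', mul_sub, mul_sub, mul_div_cancel₀ _ hx.ne'] at h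
    rw [Real.negMulLog]
    linarith

/-- The entropy of a finite family of total mass `q` is largest when the family is constant. -/
theorem sum_negMulLog_le {α : Type*} (s : Finset α) (p : α → ℝ) (hp : ∀ a ∈ s, 0 ≤ p a) :
    ∑ a ∈ s, Real.negMulLog (p a) ≤
      Real.negMulLog (∑ a ∈ s, p a) + (∑ a ∈ s, p a) * Real.log s.card := by
  rcases (Finset.sum_nonneg hp).eq_or_lt with h | h
  · have h0 := (Finset.sum_eq_zero_iff_of_nonneg hp).1 h.symm
    rw [← h, Finset.sum_eq_zero fun a ha => by rw [h0 a ha, Real.negMulLog_zero]]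
    simp
  · have hs : s.Nonempty := by
      by_contra hs
      simp [Finset.not_nonempty_iff_eq_empty.1 hs] at h
    have hc : (0 : ℝ) < s.card := by exact_mod_cast hs.card_pos
    refine (Finset.sum_le_sum fun a ha =>
      negMulLog_le_tangent (hp a ha) (div_pos h hc)).trans_eq ?_
    rw [Finset.sum_add_distrib, ← Finset.mul_sum, Finset.sum_sub_distrib, Finset.sum_const,
      nsmul_eq_mul, mul_div_cancel₀ _ hc.ne', Real.log_div h.ne' hc.ne', Real.negMulLog]
    ring

/-- Fano's inequality for a probability vector and a guess `b`. -/
theorem sum_negMulLog_le_fano {α : Type*} (s : Finset α) (p : α → ℝ)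
    (hp : ∀ a ∈ s, 0 ≤ p a) (hsum : ∑ a ∈ s, p a = 1) {b : α} (hb : b ∈ s) :
    ∑ a ∈ s, Real.negMulLog (p a) ≤ Real.log 2 + (1 - p b) * Real.log s.card := by
  classical
  have herase : ∑ a ∈ s.erase b, p a = 1 - p b := by
    rw [← hsum, ← Finset.add_sum_erase s p hb]
    ring
  have hnonneg : 0 ≤ 1 - p b :=
    herase ▸ Finset.sum_nonneg fun a ha => hp a (Finset.mem_of_mem_erase ha)
  have h := sum_negMulLog_le (s.erase b) p fun a ha => hp a (Finset.mem_of_mem_erase ha)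
  rw [herase] at h
  have hbin : Real.negMulLog (p b) + Real.negMulLog (1 - p b) ≤ Real.log 2 := by
    rw [← Real.binEntropy_eq_negMulLog_add_negMulLog_one_sub]
    exact Real.binEntropy_le_log_two
  have hlog : Real.log (s.erase b).card ≤ Real.log s.card := by
    rcases (s.erase b).card.eq_zero_or_pos with h0 | h0
    · simp [h0, Real.log_natCast_nonneg]
    · exact Real.log_le_log (by exact_mod_cast h0)
        (by exact_mod_cast Finset.card_le_card (Finset.erase_subset b s))
  rw [← Finset.add_sum_erase s _ hb]
  linarith [mul_le_mul_of_nonneg_left hlog hnonneg]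

/-- Fano's inequality for a probability measure carried by a finite set `s` and a set `t` that
contains at most one point of `s`. -/
theorem measEnt_le_fano {α : Type*} [MeasurableSpace α] [MeasurableSingletonClass α]
    (ν : Measure α) [IsProbabilityMeasure ν] (s : Finset α) (hs : ν (s : Set α)ᶜ = 0)
    {t : Set α} (ht : MeasurableSet t) (hsub : (s ∩ t : Set α).Subsingleton) :
    measEnt ν ≤ Real.log 2 + ν.real tᶜ * Real.log s.card := by
  have hent : measEnt ν = ∑ a ∈ s, Real.negMulLog (ν.real {a}) := by
    refine tsum_eq_sum fun a ha => ?_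
    have : ν {a} = 0 := measure_mono_null (by simpa using ha) hs
    simp [this]
  have hsum : ∑ a ∈ s, ν.real {a} = 1 := by
    rw [sum_measureReal_singleton, ← probReal_univ (μ := ν)]
    exact measureReal_congr (by simpa [Filter.eventuallyEq_univ, mem_ae_iff] using hs)
  have hinter : ν.real t = ν.real (s ∩ t) := by
    refine measureReal_congr (Filter.EventuallyEq.symm ?_)
    exact Filter.inter_eventuallyEq_right.2 (by
      filter_upwards [mem_ae_iff.2 hs] with a ha _ using ha)
  rw [hent, probReal_compl_eq_one_sub ht, hinter]
  rcases hsub.eq_empty_or_singleton with h | ⟨b, h⟩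
  · have hle := sum_negMulLog_le s (fun a => ν.real {a}) fun a _ => measureReal_nonneg
    rw [hsum] at hle
    simp only [Real.negMulLog_one, zero_add] at hle
    rw [h, measureReal_empty, sub_zero]
    linarith [Real.log_nonneg (one_le_two (α := ℝ))]
  · rw [h]
    exact sum_negMulLog_le_fano s (fun a => ν.real {a}) (fun a _ => measureReal_nonneg) hsum
      (h.symm.subset rfl).1

/-- The upper tail of the standard Gaussian, relative to its upper half. -/
theorem gaussianReal_Ici_le {t : ℝ} (ht : 0 ≤ t) :
    gaussianReal 0 1 (Set.Ici t) ≤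
      ENNReal.ofReal (Real.exp (-t ^ 2 / 2)) * gaussianReal 0 1 (Set.Ici 0) := by
  rw [gaussianReal_apply _ one_ne_zero, gaussianReal_apply _ one_ne_zero,
    ← lintegral_const_mul _ (measurable_gaussianPDF 0 1), ← lintegral_indicator measurableSet_Ici,
    ← lintegral_indicator measurableSet_Ici, ← lintegral_add_right_eq_self _ t]
  refine lintegral_mono fun x => ?_
  by_cases hx : 0 ≤ x
  · rw [Set.indicator_of_mem (by simpa using hx), Set.indicator_of_mem (by simpa using hx),
      gaussianPDF, gaussianPDF, ← ENNReal.ofReal_mul (Real.exp_nonneg _)]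
    refine ENNReal.ofReal_le_ofReal ?_
    rw [gaussianPDFReal, gaussianPDFReal, mul_left_comm, ← Real.exp_add]
    refine mul_le_mul_of_nonneg_left (Real.exp_le_exp.2 ?_) (by positivity)
    simp only [NNReal.coe_one]
    nlinarith [mul_nonneg hx ht]
  · rw [Set.indicator_of_notMem (by simpa using hx)]
    exact zero_le

/-- Two-sided tail bound for the standard Gaussian, with constant one. -/
theorem gaussianReal_abs_ge_le {t : ℝ} (ht : 0 ≤ t) :
    gaussianReal 0 1 {x | t ≤ |x|} ≤ ENNReal.ofReal (Real.exp (-t ^ 2 / 2)) := by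
  have hneg (u : ℝ) : gaussianReal 0 1 (Set.Iic (-u)) = gaussianReal 0 1 (Set.Ici u) := by
    conv_lhs => rw [← neg_zero, ← gaussianReal_map_neg]
    rw [Measure.map_apply measurable_neg measurableSet_Iic]
    congr 1
    ext x
    simp
  have hset : {x : ℝ | t ≤ |x|} = Set.Ici t ∪ Set.Iic (-t) := by
    ext x
    simp [le_abs, le_neg]
  have hhalf : gaussianReal 0 1 (Set.Ici 0) = gaussianReal 0 1 (Set.Iio 0) := by
    have := nullSingletonClass_gaussianReal (μ := 0) (v := 1) one_ne_zero
    rw [← hneg 0, neg_zero, measure_congr Iio_ae_eq_Iic]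
  calc gaussianReal 0 1 {x | t ≤ |x|}
      ≤ gaussianReal 0 1 (Set.Ici t) + gaussianReal 0 1 (Set.Iic (-t)) :=
        hset ▸ measure_union_le _ _
    _ ≤ ENNReal.ofReal (Real.exp (-t ^ 2 / 2)) *
          (gaussianReal 0 1 (Set.Ici 0) + gaussianReal 0 1 (Set.Ici 0)) := by
        rw [hneg, mul_add]
        exact add_le_add (gaussianReal_Ici_le ht) (gaussianReal_Ici_le ht)
    _ = ENNReal.ofReal (Real.exp (-t ^ 2 / 2)) := by
        conv_lhs => enter [2, 2]; rw [hhalf]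
        rw [← Set.compl_Ici, measure_add_measure_compl measurableSet_Ici, measure_univ, mul_one]

/-- Averaging the conditional distribution of the sections of `s` gives the joint probability. -/
theorem lintegral_condDistrib_section {Ω α β : Type*} [MeasurableSpace Ω] [MeasurableSpace α]
    [StandardBorelSpace α] [Nonempty α] [MeasurableSpace β] (μ : Measure Ω) [IsFiniteMeasure μ]
    {A : Ω → α} {Y : Ω → β} (hA : Measurable A) (hY : Measurable Y)
    {s : Set (β × α)} (hs : MeasurableSet s) :
    ∫⁻ ω, condDistrib A Y μ (Y ω) (Prod.mk (Y ω) ⁻¹' s) ∂μ = μ {ω | (Y ω, A ω) ∈ s} := by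
  rw [← lintegral_map (f := fun y => condDistrib A Y μ y (Prod.mk y ⁻¹' s))
      (Kernel.measurable_kernel_prodMk_left hs) hY, ← Measure.compProd_apply hs,
    compProd_map_condDistrib hA.aemeasurable, Measure.map_apply (hY.prodMk hA) hs]
  rfl

/-- **Lemma 1's Fano step.** If `A` takes values in a finite set `𝒜 ⊆ ℝ^τ`, the received
points `∑ k, λ k * a k`, `a ∈ 𝒜`, are pairwise at distance at least `d > 0`, and
`Y = ∑ k, λ k * A k + Z` with `Z` standard Gaussian independent of `A`, then
`H(A | Y) ≤ log 2 + exp (-d²/8) * log |𝒜|`. -/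
theorem fano_min_distance_bound
    {Ω : Type*} [MeasurableSpace Ω] (μ : Measure Ω) [IsProbabilityMeasure μ]
    (τ : ℕ) (hτ : 0 < τ) (𝒜 : Finset (Fin τ → ℝ)) (h𝒜 : 𝒜.Nonempty)
    (lam : Fin τ → ℝ) (d : ℝ) (hd : 0 < d)
    (hsep : ∀ a ∈ 𝒜, ∀ a' ∈ 𝒜, a ≠ a' →
      d ≤ |∑ k, lam k * a k - ∑ k, lam k * a' k|)
    (A : Ω → Fin τ → ℝ) (hA : Measurable A) (hA𝒜 : ∀ ω, A ω ∈ 𝒜)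
    (Z : Ω → ℝ) (hZ : Measurable Z)
    (hZlaw : μ.map Z = gaussianReal 0 1)
    (hAZ : IndepFun A Z μ) :
    condEntReal μ A (fun ω => (∑ k, lam k * A ω k) + Z ω) ≤
      Real.log 2 + Real.exp (-d ^ 2 / 8) * Real.log (𝒜.card : ℝ) := by
  have hφ : Measurable fun a : Fin τ → ℝ => ∑ k, lam k * a k := by fun_prop
  set Y : Ω → ℝ := fun ω => (∑ k, lam k * A ω k) + Z ω with hYdef
  have hY : Measurable Y := (hφ.comp hA).add hZ
  set far : Set (ℝ × (Fin τ → ℝ)) := {q | d / 2 ≤ |q.1 - ∑ k, lam k * q.2 k|} with hfar_def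
  have hfar : MeasurableSet far := by
    refine measurableSet_le measurable_const ?_
    exact (measurable_fst.sub (hφ.comp measurable_snd)).abs
  have hsection (y : ℝ) : MeasurableSet (Prod.mk y ⁻¹' far) := measurable_prodMk_left hfar
  set g : Ω → ℝ := fun ω => (condDistrib A Y μ (Y ω)).real (Prod.mk (Y ω) ⁻¹' far)
  have hg_meas : Measurable g :=
    ((Kernel.measurable_kernel_prodMk_left (κ := condDistrib A Y μ) hfar).comp hY).ennreal_toReal
  have hg_int : Integrable g μ := by
    refine Integrable.of_bound hg_meas.aestronglyMeasurable 1 (ae_of_all _ fun ω => ?_)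
    rw [Real.norm_of_nonneg measureReal_nonneg]
    exact measureReal_le_one
  have hg_le : ∫ ω, g ω ∂μ ≤ Real.exp (-d ^ 2 / 8) := by
    rw [integral_eq_lintegral_of_nonneg_ae (ae_of_all _ fun _ => measureReal_nonneg)
      hg_meas.aestronglyMeasurable]
    refine ENNReal.toReal_le_of_le_ofReal (Real.exp_nonneg _) ?_
    have hofReal (ω : Ω) : ENNReal.ofReal (g ω) =
        condDistrib A Y μ (Y ω) (Prod.mk (Y ω) ⁻¹' far) := ofReal_measureReal
    rw [lintegral_congr hofReal, lintegral_condDistrib_section μ hA hY hfar]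
    have hZset : {ω | (Y ω, A ω) ∈ far} = Z ⁻¹' {x | d / 2 ≤ |x|} := by
      ext ω
      simp [hfar_def, hYdef]
    have hmeas : MeasurableSet {x : ℝ | d / 2 ≤ |x|} :=
      measurableSet_le measurable_const measurable_id.abs
    rw [hZset, ← Measure.map_apply hZ hmeas, hZlaw]
    refine (gaussianReal_abs_ge_le (by positivity)).trans_eq ?_
    congr 2
    ring
  have hsupp : ∀ᵐ ω ∂μ, condDistrib A Y μ (Y ω) (𝒜 : Set (Fin τ → ℝ))ᶜ = 0 := by
    have hmeas : MeasurableSet (Prod.snd ⁻¹' (𝒜 : Set (Fin τ → ℝ))ᶜ : Set (ℝ × (Fin τ → ℝ))) :=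
      measurable_snd 𝒜.measurableSet.compl
    have h := lintegral_condDistrib_section μ hA hY hmeas
    simp only [Set.mem_preimage, Set.mem_compl_iff, Finset.mem_coe, hA𝒜, not_true_eq_false,
      Set.ofPred_false, measure_empty] at h
    exact (lintegral_eq_zero_iff
      ((Kernel.measurable_coe _ 𝒜.measurableSet.compl).comp hY)).1 h
  have hsub (y : ℝ) : ((𝒜 : Set (Fin τ → ℝ)) ∩ (Prod.mk y ⁻¹' far)ᶜ).Subsingleton := by
    rintro a ⟨ha, hay⟩ b ⟨hb, hby⟩
    by_contra hab
    simp only [hfar_def, Set.mem_compl_iff, Set.mem_preimage, Set.mem_ofPred_eq, not_le] at hay hby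
    have htri := abs_sub_le (∑ k, lam k * a k) y (∑ k, lam k * b k)
    rw [abs_sub_comm _ y] at htri
    linarith [hsep a ha b hb hab]
  calc condEntReal μ A Y
      ≤ ∫ ω, (Real.log 2 + g ω * Real.log (𝒜.card : ℝ)) ∂μ := by
        refine integral_mono_of_nonneg (ae_of_all _ fun ω => ?_)
          ((integrable_const _).add (hg_int.mul_const _)) ?_
        · exact tsum_nonneg fun a => Real.negMulLog_nonneg ENNReal.toReal_nonneg measureReal_le_one
        · filter_upwards [hsupp] with ω hω
          simpa [g] using measEnt_le_fano _ 𝒜 hω (hsection (Y ω)).compl (hsub (Y ω))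
    _ = Real.log 2 + (∫ ω, g ω ∂μ) * Real.log (𝒜.card : ℝ) := by
        rw [integral_add (integrable_const _) (hg_int.mul_const _), integral_mul_const]
        simp
    _ ≤ Real.log 2 + Real.exp (-d ^ 2 / 8) * Real.log (𝒜.card : ℝ) := by
        gcongr
end

section
/- Let M ≥ 2 and 2 ≤ N ≤ M be integers and let α ≥ 0 be a real number. Then there exist real numbers λ_0, λ_1, λ_2 ≥ 0 with λ_0 + λ_1 + λ_2 = 1 such that λ_1·(M−1)/(MN) + λ_2·(2/N) ≤ α and λ_1·(M−1)/M + λ_2 = min{Nα, (Nα+M−1)/(M+1), 1}. -/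
/-- **Time-sharing achievability (footnote 6 of the paper).** For `2 ≤ M`, `2 ≤ N ≤ M` and
real `α ≥ 0`, there are convex weights `λ₀, λ₁, λ₂` on the operating points `(0, 0)`,
`((M-1)/(MN), (M-1)/M)` and `(2/N, 1)` whose link d.o.f. combination is at most `α` and whose
secure d.o.f. combination equals `min {Nα, (Nα+M-1)/(M+1), 1}`. -/
theorem sdof_time_sharing (M N : ℕ) (hM : 2 ≤ M) (hN : 2 ≤ N) (hNM : N ≤ M)
    (α : ℝ) (hα : 0 ≤ α) :
    ∃ l0 l1 l2 : ℝ, 0 ≤ l0 ∧ 0 ≤ l1 ∧ 0 ≤ l2 ∧ l0 + l1 + l2 = 1 ∧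
      l1 * (((M : ℝ) - 1) / ((M : ℝ) * N)) + l2 * (2 / (N : ℝ)) ≤ α ∧
      l1 * (((M : ℝ) - 1) / M) + l2 =
        min ((N : ℝ) * α) (min (((N : ℝ) * α + M - 1) / (M + 1)) 1) := by
  have hm : (2 : ℝ) ≤ M := by exact_mod_cast hM
  have hn : (0 : ℝ) < N := by
    have : (2 : ℝ) ≤ N := by exact_mod_cast hN
    linarith
  generalize (M : ℝ) = m at *
  generalize (N : ℝ) = n at *
  obtain ⟨x, rfl⟩ : ∃ x, α = x / n := ⟨n * α, by field_simp⟩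
  have hx : 0 ≤ x := by
    have := mul_nonneg hα hn.le
    rwa [div_mul_cancel₀ _ hn.ne'] at this
  have hm0 : 0 < m := by linarith
  have hm1 : 0 < m - 1 := by linarith
  have hm2 : 0 < m + 1 := by linarith
  rw [mul_div_cancel₀ _ hn.ne']
  rcases le_total (m * x) (m - 1) with h | h
  · have hx1 : x ≤ 1 := by nlinarith
    refine ⟨1 - m * x / (m - 1), m * x / (m - 1), 0, ?_, by positivity, le_rfl, by ring,
      le_of_eq (by field_simp; ring), ?_⟩
    · rw [sub_nonneg, div_le_one hm1]
      exact h
    · rw [min_eq_left (le_min ((le_div_iff₀ hm2).2 (by linarith)) hx1)]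
      field_simp
      ring
  · rcases le_total x 2 with h2 | h2
    · refine ⟨0, m * (2 - x) / (m + 1), (m * x - (m - 1)) / (m + 1), le_rfl,
        div_nonneg (mul_nonneg hm0.le (by linarith)) hm2.le,
        div_nonneg (by linarith) hm2.le, by field_simp; ring,
        le_of_eq (by field_simp; ring), ?_⟩
      rw [min_eq_left ((div_le_one hm2).2 (by linarith)),
        min_eq_right ((div_le_iff₀ hm2).2 (by linarith))]
      field_simp
      ring
    · refine ⟨0, 0, 1, le_rfl, le_rfl, zero_le_one, by ring, ?_, ?_⟩
      · rw [zero_mul, zero_add, one_mul]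
        gcongr
      · rw [min_eq_right ((one_le_div hm2).2 (by linarith)), min_eq_right (by linarith)]
        ring
end

section
/- Let M ≥ 2 and 2 ≤ N ≤ M be integers, let α ≥ 0 be real, and let λ_1, λ_2 ≥ 0 be reals with λ_1 + λ_2 ≤ 1 and λ_1·(M−1)/(MN) + λ_2·(2/N) ≤ α. Then λ_1·(M−1)/M + λ_2 ≤ min{Nα, (Nα+M−1)/(M+1), 1}. -/
/-- **Converse direction of the time-sharing argument for Theorem 2.** For `2 ≤ M`,
`2 ≤ N ≤ M`, real `α ≥ 0` and nonnegative weights `λ₁, λ₂` with `λ₁ + λ₂ ≤ 1` whose link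
d.o.f. combination is at most `α`, the corresponding secure d.o.f. combination
`λ₁ (M-1)/M + λ₂` cannot exceed `min {Nα, (Nα+M-1)/(M+1), 1}`. -/
theorem sdof_time_sharing_converse (M N : ℕ) (hM : 2 ≤ M) (hN : 2 ≤ N) (hNM : N ≤ M)
    (α : ℝ) (hα : 0 ≤ α) (l1 l2 : ℝ) (h1 : 0 ≤ l1) (h2 : 0 ≤ l2) (hsum : l1 + l2 ≤ 1)
    (hlink : l1 * (((M : ℝ) - 1) / ((M : ℝ) * N)) + l2 * (2 / (N : ℝ)) ≤ α) :
    l1 * (((M : ℝ) - 1) / M) + l2 ≤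
      min ((N : ℝ) * α) (min (((N : ℝ) * α + M - 1) / (M + 1)) 1) := by
  have hM' : (2 : ℝ) ≤ M := by exact_mod_cast hM
  have hN' : (0 : ℝ) < N := by exact_mod_cast (by omega : 0 < N)
  have hM0 : (0 : ℝ) < M := by linarith
  obtain ⟨t, ht⟩ : ∃ t : ℝ, t = ((M : ℝ) - 1) / M := ⟨_, rfl⟩
  have htM : t * M = M - 1 := by rw [ht]; field_simp
  have ht1 : t ≤ 1 := by rw [ht, div_le_one hM0]; linarith
  have hload : l1 * t + 2 * l2 ≤ N * α := by
    calc l1 * t + 2 * l2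
        = N * (l1 * (((M : ℝ) - 1) / ((M : ℝ) * N)) + l2 * (2 / (N : ℝ))) := by
          rw [ht]; field_simp
      _ ≤ N * α := mul_le_mul_of_nonneg_left hlink hN'.le
  rw [← ht]
  refine le_min (by linarith) (le_min ?_ ?_)
  · rw [le_div_iff₀ (by linarith)]
    have hw : (l1 + l2) * ((M : ℝ) - 1) ≤ 1 * (M - 1) :=
      mul_le_mul_of_nonneg_right hsum (by linarith)
    linear_combination hload + hw + l1 * htM
  · linarith [mul_le_mul_of_nonneg_left ht1 h1]
end
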